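/- Let a, b, f be positive real numbers and let e be a real number with a ≤ e. Then (a + a·b + a·f − b·f)·(f + e·f + a·f − a·e)/(f·(1+b+e)) ≤ (a + a·b + a·f − b·f)·(f + 2·a·f − a²)/(f·(1+a+b)). -/

import Mathlib

/-- The area `|FGA|` is a nonincreasing function of the parameter `e`; bounding it by
its value at `e = a` (using `e ≥ a`). -/
theorem FGA_bound (a b e f : ℝ) (ha : 0 < a) (hb : 0 < b) (hf : 0 < f) (hae : a ≤ e) :
    (a + a * b + a * f - b * f) * (f + e * f + a * f - a * e) / (f * (1 + b + e)) ≤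
      (a + a * b + a * f - b * f) * (f + 2 * a * f - a ^ 2) / (f * (1 + a + b)) := by
  have hD : 0 < 1 + b + e := by linarith
  have hDa : 0 < 1 + a + b := by linarith
  rw [div_le_div_iff₀ (mul_pos hf hD) (mul_pos hf hDa)]
  have key : 0 ≤ f * ((e - a) * (a + a * b + a * f - b * f) ^ 2) :=
    mul_nonneg hf.le (mul_nonneg (sub_nonneg.2 hae) (sq_nonneg _))
  linear_combination key
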